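/- Consider a secretive shared-cache scheme with parameters (Λ, K, M, M_U = 1, N, B) and rate R, with association profile L = (L_1,…,L_Λ) and users ordered so that users 1, …, L_1 are attached to cache 1. If N ≥ 2K, then R ≥ L_1. -/

import Mathlib

noncomputable section

/-- Probability of an event `E` on a finite sample space with weight function `p`. -/
def pr {Ω : Type*} [Fintype Ω] (p : Ω → ℝ) (E : Set Ω) : ℝ :=
  ∑ ω : Ω, E.indicator p ω

/-- Shannon entropy (in bits) of a random variable `X` on a finite probability space
`(Ω, p)`: `H(X) = -∑_x P[X = x] log₂ P[X = x]`, written as the expectation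
`∑_ω p ω · (− log₂ P[X = X ω])`. -/
def ent {Ω α : Type*} [Fintype Ω] (p : Ω → ℝ) (X : Ω → α) : ℝ :=
  ∑ ω : Ω, p ω * (-Real.logb 2 (pr p {ω' | X ω' = X ω}))

/-- Conditional Shannon entropy `H(X | Y) = H(X, Y) − H(Y)` in bits. -/
def condEnt {Ω α β : Type*} [Fintype Ω] (p : Ω → ℝ) (X : Ω → α) (Y : Ω → β) : ℝ :=
  ent p (fun ω => (X ω, Y ω)) - ent p Y

/-- Mutual information `I(X ; Y) = H(X) + H(Y) − H(X, Y)` in bits. -/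
def mutInf {Ω α β : Type*} [Fintype Ω] (p : Ω → ℝ) (X : Ω → α) (Y : Ω → β) : ℝ :=
  ent p X + ent p Y - ent p (fun ω => (X ω, Y ω))

section Entropy

open Finset

variable {Ω : Type*} [Fintype Ω] {p : Ω → ℝ}

lemma pr_nonneg (hp : ∀ ω, 0 ≤ p ω) (E : Set Ω) : 0 ≤ pr p E :=
  sum_nonneg fun ω _ => Set.indicator_nonneg (fun ω _ => hp ω) ω

lemma pr_mono (hp : ∀ ω, 0 ≤ p ω) {E F : Set Ω} (h : E ⊆ F) : pr p E ≤ pr p F :=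
  sum_le_sum fun ω _ => Set.indicator_le_indicator_of_subset h hp ω

lemma le_pr (hp : ∀ ω, 0 ≤ p ω) {E : Set Ω} {ω : Ω} (h : ω ∈ E) : p ω ≤ pr p E := by
  rw [← Set.indicator_of_mem h p]
  exact single_le_sum (f := fun ω => E.indicator p ω)
    (fun ω _ => Set.indicator_nonneg (fun ω _ => hp ω) ω) (mem_univ ω)

lemma pr_univ : pr p Set.univ = ∑ ω, p ω := by simp [pr]

/-- Entropy decreases under passing to a coarser random variable. -/
lemma ent_le_of_determines {α β : Type*} (hp : ∀ ω, 0 ≤ p ω) {X : Ω → α} {Y : Ω → β}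
    (h : ∀ ω ω', X ω = X ω' → Y ω = Y ω') : ent p Y ≤ ent p X := by
  refine sum_le_sum fun ω _ => ?_
  rcases (hp ω).eq_or_lt with h0 | h0
  · simp [← h0]
  · refine mul_le_mul_of_nonneg_left (neg_le_neg ?_) h0.le
    refine Real.logb_le_logb_of_le one_lt_two (h0.trans_le (le_pr hp (by simp))) ?_
    exact pr_mono hp fun ω' h' => h _ _ h'

lemma ent_nonneg {α : Type*} (hp : ∀ ω, 0 ≤ p ω) (hp1 : ∑ ω, p ω = 1) (X : Ω → α) :
    0 ≤ ent p X := by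
  refine sum_nonneg fun ω _ => mul_nonneg (hp ω) (neg_nonneg.2 ?_)
  refine Real.logb_nonpos one_lt_two (pr_nonneg hp _) ?_
  rw [← hp1, ← pr_univ]
  exact pr_mono hp (Set.subset_univ _)

lemma ent_of_pr_eq {α : Type*} (hp1 : ∑ ω, p ω = 1) {X : Ω → α} {c : ℝ}
    (h : ∀ ω, pr p {ω' | X ω' = X ω} = c) : ent p X = -Real.logb 2 c := by
  simp [ent, h, ← sum_mul, hp1]

lemma sum_div_pr_le_one {α : Type*} (hp : ∀ ω, 0 ≤ p ω) {J : Ω → α} {E : Set Ω}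
    (hE : ∀ ω ∈ E, ∀ ω' ∈ E, J ω = J ω') :
    ∑ ω, E.indicator (fun ω => p ω / pr p {ω' | J ω' = J ω}) ω ≤ 1 := by
  rcases E.eq_empty_or_nonempty with rfl | ⟨ω₀, h₀⟩
  · simp
  calc ∑ ω, E.indicator (fun ω => p ω / pr p {ω' | J ω' = J ω}) ω
      ≤ ∑ ω, {ω | J ω = J ω₀}.indicator p ω / pr p {ω' | J ω' = J ω₀} := by
        refine sum_le_sum fun ω _ => ?_
        by_cases h : ω ∈ E
        · have : J ω = J ω₀ := hE _ h _ h₀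
          simp [h, this]
        · rw [Set.indicator_of_notMem h]
          exact div_nonneg (Set.indicator_nonneg (fun ω _ => hp ω) ω) (pr_nonneg hp _)
    _ = pr p {ω' | J ω' = J ω₀} / pr p {ω' | J ω' = J ω₀} := by rw [← sum_div]; rfl
    _ ≤ 1 := div_self_le_one _

lemma sum_mul_pr_ratio_le_one {α β γ δ : Type*} (hp : ∀ ω, 0 ≤ p ω) (hp1 : ∑ ω, p ω = 1)
    {X : Ω → α} {Y : Ω → β} {J : Ω → γ} {Z : Ω → δ}
    (hXZ : ∀ ω ω', X ω = X ω' → Z ω = Z ω') (hYZ : ∀ ω ω', Y ω = Y ω' → Z ω = Z ω')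
    (hJ : ∀ ω ω', X ω = X ω' → Y ω = Y ω' → J ω = J ω') :
    ∑ ω, p ω * (pr p {ω' | X ω' = X ω} * pr p {ω' | Y ω' = Y ω} /
      (pr p {ω' | J ω' = J ω} * pr p {ω' | Z ω' = Z ω})) ≤ 1 := by
  classical
  calc ∑ ω, p ω * (pr p {ω' | X ω' = X ω} * pr p {ω' | Y ω' = Y ω} /
        (pr p {ω' | J ω' = J ω} * pr p {ω' | Z ω' = Z ω}))
      = ∑ ω, ∑ ω₁, ∑ ω₂, (if X ω₁ = X ω then p ω₁ else 0) * (if Y ω₂ = Y ω then p ω₂ else 0) *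
          (p ω / (pr p {ω' | J ω' = J ω} * pr p {ω' | Z ω' = Z ω})) := by
        refine sum_congr rfl fun ω _ => ?_
        simp_rw [← sum_mul, ← mul_sum, ← sum_mul]
        simp only [pr, Set.indicator_apply, Set.mem_ofPred_eq]
        ring
    _ = ∑ ω₁, ∑ ω₂, ∑ ω, (if X ω₁ = X ω then p ω₁ else 0) * (if Y ω₂ = Y ω then p ω₂ else 0) *
          (p ω / (pr p {ω' | J ω' = J ω} * pr p {ω' | Z ω' = Z ω})) := by
        rw [sum_comm]
        exact sum_congr rfl fun ω _ => sum_comm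
    _ ≤ ∑ ω₁, ∑ ω₂, (p ω₁ / pr p {ω' | Z ω' = Z ω₁}) * (if Z ω₂ = Z ω₁ then p ω₂ else 0) := by
        refine sum_le_sum fun ω₁ _ => sum_le_sum fun ω₂ _ => ?_
        by_cases hZ : Z ω₂ = Z ω₁
        · rw [if_pos hZ]
          have key := sum_div_pr_le_one (p := p) (J := J) hp
            (E := {ω | X ω₁ = X ω ∧ Y ω₂ = Y ω})
            (fun ω h ω' h' => hJ _ _ (h.1.symm.trans h'.1) (h.2.symm.trans h'.2))
          have hc : 0 ≤ p ω₁ / pr p {ω' | Z ω' = Z ω₁} * p ω₂ :=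
            mul_nonneg (div_nonneg (hp _) (pr_nonneg hp _)) (hp _)
          refine le_trans (le_of_eq ?_) (mul_le_of_le_one_right hc key)
          rw [mul_sum]
          refine sum_congr rfl fun ω _ => ?_
          by_cases hX : X ω₁ = X ω
          · by_cases hY : Y ω₂ = Y ω
            · simp only [hX, hY, Set.indicator_apply, Set.mem_ofPred_eq, if_true, and_self,
                hXZ _ _ hX, div_eq_mul_inv, mul_inv]
              ring
            · simp [hY]
          · simp [hX]
        · rw [if_neg hZ, mul_zero]
          refine le_of_eq (sum_eq_zero fun ω _ => ?_)
          by_cases hX : X ω₁ = X ω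
          · have hY : Y ω₂ ≠ Y ω := fun hY => hZ ((hYZ _ _ hY).trans (hXZ _ _ hX).symm)
            simp [hY]
          · simp [hX]
    _ = ∑ ω₁, (p ω₁ / pr p {ω' | Z ω' = Z ω₁}) * pr p {ω' | Z ω' = Z ω₁} := by
        refine sum_congr rfl fun ω₁ _ => ?_
        rw [← mul_sum]
        simp [pr, Set.indicator_apply]
    _ ≤ ∑ ω, p ω := by
        refine sum_le_sum fun ω _ => ?_
        rw [div_mul_eq_mul_div, mul_div_assoc]
        exact mul_le_of_le_one_right (hp ω) (div_self_le_one _)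
    _ = 1 := hp1

/-- Submodularity of entropy: `J` is determined by `(X, Y)`, and `Z` is determined both by `X`
and by `Y`. -/
lemma ent_submodular {α β γ δ : Type*} (hp : ∀ ω, 0 ≤ p ω) (hp1 : ∑ ω, p ω = 1)
    {X : Ω → α} {Y : Ω → β} {J : Ω → γ} {Z : Ω → δ}
    (hXZ : ∀ ω ω', X ω = X ω' → Z ω = Z ω') (hYZ : ∀ ω ω', Y ω = Y ω' → Z ω = Z ω')
    (hJ : ∀ ω ω', X ω = X ω' → Y ω = Y ω' → J ω = J ω') :
    ent p J + ent p Z ≤ ent p X + ent p Y := by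
  have key := sum_mul_pr_ratio_le_one hp hp1 hXZ hYZ hJ
  have hlog2 : 0 < Real.log 2 := Real.log_pos one_lt_two
  have hsum : (ent p J + ent p Z - (ent p X + ent p Y)) * Real.log 2 ≤
      ∑ ω, (p ω * (pr p {ω' | X ω' = X ω} * pr p {ω' | Y ω' = Y ω} /
        (pr p {ω' | J ω' = J ω} * pr p {ω' | Z ω' = Z ω})) - p ω) := by
    simp only [ent]
    rw [← sum_add_distrib, ← sum_add_distrib, ← sum_sub_distrib, sum_mul]
    refine sum_le_sum fun ω _ => ?_
    rcases (hp ω).eq_or_lt with h0 | h0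
    · simp [← h0]
    have hx : 0 < pr p {ω' | X ω' = X ω} := h0.trans_le (le_pr hp (by simp))
    have hy : 0 < pr p {ω' | Y ω' = Y ω} := h0.trans_le (le_pr hp (by simp))
    have hj : 0 < pr p {ω' | J ω' = J ω} := h0.trans_le (le_pr hp (by simp))
    have hz : 0 < pr p {ω' | Z ω' = Z ω} := h0.trans_le (le_pr hp (by simp))
    have hl := Real.log_le_sub_one_of_pos (div_pos (mul_pos hx hy) (mul_pos hj hz))
    rw [Real.log_div (mul_pos hx hy).ne' (mul_pos hj hz).ne', Real.log_mul hx.ne' hy.ne',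
      Real.log_mul hj.ne' hz.ne'] at hl
    have hl' := mul_le_mul_of_nonneg_left hl h0.le
    simp only [Real.logb]
    refine le_trans (le_of_eq ?_) (hl'.trans (le_of_eq ?_))
    · field_simp
      ring
    · ring
  rw [sum_sub_distrib, hp1] at hsum
  nlinarith

lemma condEnt_anti {α β γ : Type*} (hp : ∀ ω, 0 ≤ p ω) (hp1 : ∑ ω, p ω = 1)
    (X : Ω → α) {T : Ω → β} {S : Ω → γ} (h : ∀ ω ω', T ω = T ω' → S ω = S ω') :
    condEnt p X T ≤ condEnt p X S := by
  have := ent_submodular hp hp1 (X := fun ω => (X ω, S ω)) (Y := T) (Z := S)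
    (J := fun ω => (X ω, T ω)) (fun ω ω' e => (Prod.ext_iff.1 e).2) h
    (fun ω ω' e e' => Prod.ext (Prod.ext_iff.1 e).1 e')
  unfold condEnt
  linarith

lemma condEnt_le_ent {α β : Type*} (hp : ∀ ω, 0 ≤ p ω) (hp1 : ∑ ω, p ω = 1)
    (X : Ω → α) (T : Ω → β) : condEnt p X T ≤ ent p X := by
  have h := ent_submodular hp hp1 (X := X) (Y := T) (Z := fun _ => ())
    (J := fun ω => (X ω, T ω)) (fun _ _ _ => rfl) (fun _ _ _ => rfl)
    (fun ω ω' e e' => Prod.ext e e')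
  have h0 := ent_nonneg hp hp1 (fun _ : Ω => ())
  unfold condEnt
  linarith

lemma ent_pair_le {α β : Type*} (hp : ∀ ω, 0 ≤ p ω) (hp1 : ∑ ω, p ω = 1)
    (X : Ω → α) (T : Ω → β) : ent p (fun ω => (X ω, T ω)) ≤ ent p X + ent p T := by
  have := condEnt_le_ent hp hp1 X T
  unfold condEnt at this
  linarith

/-- Chain rule bound: adjoining a finite family costs at most the sum of the conditional
entropies. -/
lemma ent_family_le {ι β : Type*} {τ : ι → Type*} (hp : ∀ ω, 0 ≤ p ω) (hp1 : ∑ ω, p ω = 1)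
    (F : ∀ i, Ω → τ i) (T : Ω → β) (s : Finset ι) :
    ent p (fun ω => (T ω, fun i : s => F i ω)) ≤ ent p T + ∑ i ∈ s, condEnt p (F i) T := by
  classical
  induction s using Finset.induction_on with
  | empty =>
    rw [sum_empty, add_zero]
    refine ent_le_of_determines hp fun ω ω' h => Prod.ext h ?_
    funext i
    exact absurd i.2 (notMem_empty _)
  | insert a s ha ih =>
    rw [sum_insert ha]
    have h := ent_submodular hp hp1 (X := fun ω => (F a ω, T ω))
      (Y := fun ω => (T ω, fun i : s => F i ω)) (Z := T)
      (J := fun ω => (T ω, fun i : (insert a s : Finset ι) => F i ω))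
      (fun ω ω' e => (Prod.ext_iff.1 e).2) (fun ω ω' e => (Prod.ext_iff.1 e).1)
      (fun ω ω' e e' => by
        refine Prod.ext (Prod.ext_iff.1 e).2 ?_
        funext ⟨i, hi⟩
        rcases mem_insert.1 hi with rfl | hi
        · exact (Prod.ext_iff.1 e).1
        · exact congrFun (Prod.ext_iff.1 e').2 ⟨i, hi⟩)
    have hc : condEnt p (F a) T = ent p (fun ω => (F a ω, T ω)) - ent p T := rfl
    linarith

end Entropy

/-- for any secretive shared-cache scheme with parameters
`(Λ, K, M, M_U = 1, N, B)` and rate `R`, with association profile `L = (L₁,…,L_Λ)` and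
users ordered so that users `1, …, L₁` (i.e. the users `k` with `k.val < L₁` under
0-indexing) are attached to cache 1, if `N ≥ 2K` then `R ≥ L₁`. -/
theorem statement14
    -- parameters (the user-cache memory is M_U = 1), with N ≥ 2K
    (Λ K N B : ℕ) (M R : ℝ) (hΛ : 0 < Λ) (hB : 0 < B) (hN : 2 * K ≤ N)
    -- association profile and user-to-cache assignment; cache 1 serves users 1,…,L₁
    (L : Fin Λ → ℕ) (hL : Antitone L) (hKsum : ∑ l : Fin Λ, L l = K)
    (lam : Fin K → Fin Λ)
    (hlam1 : ∀ k : Fin K, k.val < L ⟨0, hΛ⟩ → lam k = ⟨0, hΛ⟩)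
    -- the underlying finite probability space
    (Ω : Type) [Fintype Ω] (p : Ω → ℝ) (hp0 : ∀ ω : Ω, 0 ≤ p ω) (hp1 : ∑ ω : Ω, p ω = 1)
    -- the `N` files: mutually independent, each uniform over a set of size `2^B`
    (W : Fin N → Ω → Fin (2 ^ B))
    (hWunif : ∀ (n : Fin N) (w : Fin (2 ^ B)), pr p {ω | W n ω = w} = 1 / (2 ^ B : ℝ))
    (hWind : ∀ w : Fin N → Fin (2 ^ B),
      pr p {ω | ∀ n : Fin N, W n ω = w n} = ∏ n : Fin N, pr p {ω | W n ω = w n})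
    -- helper-cache contents
    (ZT : Fin Λ → Type) (Z : ∀ l : Fin Λ, Ω → ZT l)
    (hZ : ∀ l : Fin Λ, ent p (Z l) ≤ M * B)
    -- user-cache contents, of size `M_U = 1` file
    (UT : Fin K → Type) (U : ∀ k : Fin K, Ω → UT k)
    (hU : ∀ k : Fin K, ent p (U k) ≤ 1 * B)
    -- transmissions
    (XT : (Fin K → Fin N) → Type) (X : ∀ d : Fin K → Fin N, Ω → XT d)
    (hX : ∀ d : Fin K → Fin N, ent p (X d) ≤ R * B)
    -- decodability
    (hdec : ∀ (d : Fin K → Fin N) (k : Fin K),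
      condEnt p (W (d k)) (fun ω => (X d ω, Z (lam k) ω, U k ω)) = 0)
    -- secrecy
    (hsec : ∀ (d : Fin K → Fin N) (k : Fin K),
      mutInf p (fun ω (n : {n : Fin N // n ≠ d k}) => W n.val ω)
        (fun ω => (X d ω, Z (lam k) ω, U k ω)) = 0) :
    (L ⟨0, hΛ⟩ : ℝ) ≤ R := by
  classical
  have hB' : (0 : ℝ) < B := by exact_mod_cast hB
  have hlK : L ⟨0, hΛ⟩ ≤ K := by
    rw [← hKsum]
    exact Finset.single_le_sum (f := L) (fun _ _ => Nat.zero_le _) (Finset.mem_univ _)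
  generalize hl : L ⟨0, hΛ⟩ = l at *
  let d : Fin K → Fin N := fun k => ⟨k, by omega⟩
  let d' : Fin K → Fin N := fun k => ⟨K + k, by omega⟩
  rcases Nat.eq_zero_or_pos l with rfl | hlpos
  · have h := (ent_nonneg hp0 hp1 (X d)).trans (hX d)
    simpa using nonneg_of_mul_nonneg_left h hB'
  let k₀ : Fin K := ⟨0, by omega⟩
  have hlog : Real.logb 2 ((2 : ℝ) ^ B) = B := by
    rw [Real.logb_pow]; simp
  have hWent : ∀ n, ent p (W n) = B := fun n => by
    rw [ent_of_pr_eq hp1 (fun ω => hWunif n (W n ω)), one_div, Real.logb_inv, hlog, neg_neg]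
  have hall : ent p (fun ω n => W n ω) = N * B := by
    rw [ent_of_pr_eq hp1 (c := (1 / (2 ^ B : ℝ)) ^ N), Real.logb_pow, one_div, Real.logb_inv,
      hlog]
    · ring
    · intro ω
      have h := hWind (fun n => W n ω)
      simp only [hWunif, Finset.prod_const, Finset.card_univ, Fintype.card_fin] at h
      rw [← h]
      simp only [funext_iff]
  have hV : (N : ℝ) * B ≤
      B + ent p (fun ω (n : {n : Fin N // n ≠ d k₀}) => W n.val ω) := by
    rw [← hall, ← hWent (d k₀)]
    refine le_trans (ent_le_of_determines hp0 fun ω ω' e => ?_) (ent_pair_le hp0 hp1 _ _)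
    funext n
    by_cases hn : n = d k₀
    · rw [hn]
      exact (Prod.ext_iff.1 e).1
    · exact congrFun (Prod.ext_iff.1 e).2 ⟨n, hn⟩
  let Y := fun ω => (X d ω, Z (lam k₀) ω, U k₀ ω)
  let s : Finset (Fin K) := {k | k ≠ k₀ ∧ k.val < l}
  let T := fun ω => ((X d' ω, Y ω), fun k : s => U k ω)
  have hs : s.card + 1 ≤ l := by
    have hsub : (insert k₀ s).card ≤ (Finset.range l).card :=
      Finset.card_le_card_of_injOn (fun k => k.val)
        (fun k hk => by
          rcases Finset.mem_insert.1 (Finset.mem_coe.1 hk) with rfl | hk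
          · simpa [k₀] using hlpos
          · simpa using (Finset.mem_filter.1 hk).2.2)
        (fun _ _ _ _ h => Fin.ext h)
    rwa [Finset.card_insert_of_notMem (by simp [s]), Finset.card_range] at hsub
  have hT : ent p T ≤ R * B + ent p Y + (l - 1) * B := by
    have h1 := ent_family_le hp0 hp1 U (fun ω => (X d' ω, Y ω)) s
    have h2 := ent_pair_le hp0 hp1 (X d') Y
    have h3 : ∑ k ∈ s, condEnt p (U k) (fun ω => (X d' ω, Y ω)) ≤ ∑ k ∈ s, (B : ℝ) :=
      Finset.sum_le_sum fun k _ =>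
        (condEnt_le_ent hp0 hp1 _ _).trans ((hU k).trans_eq (one_mul _))
    rw [Finset.sum_const, nsmul_eq_mul] at h3
    have h4 : (s.card : ℝ) + 1 ≤ l := by exact_mod_cast hs
    have h5 := hX d'
    have h6 : (s.card : ℝ) * B ≤ (l - 1) * B :=
      mul_le_mul_of_nonneg_right (by linarith) hB'.le
    linarith
  have hTdet : ∀ k : Fin K, k.val < l → ∀ ω ω', T ω = T ω' →
      X d ω = X d ω' ∧ X d' ω = X d' ω' ∧ Z (lam k) ω = Z (lam k) ω' ∧ U k ω = U k ω' := by
    intro k hk ω ω' e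
    obtain ⟨e1, e2⟩ := Prod.ext_iff.1 e
    obtain ⟨e3, e4⟩ := Prod.ext_iff.1 e1
    obtain ⟨e5, e6⟩ := Prod.ext_iff.1 e4
    obtain ⟨e7, e8⟩ := Prod.ext_iff.1 e6
    refine ⟨e5, e3, ?_, ?_⟩
    · rw [hlam1 k hk, ← hlam1 k₀ hlpos]
      exact e7
    · by_cases hk0 : k = k₀
      · rw [hk0]
        exact e8
      · exact congrFun e2 ⟨k, by simp [s, hk0, hk]⟩
  let f : Fin l ⊕ Fin l → Fin N :=
    Sum.elim (fun i => d ⟨i, by omega⟩) (fun i => d' ⟨i, by omega⟩)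
  have hf : Function.Injective f := by
    rintro (i | i) (j | j) h <;> simp [f, d, d', Fin.ext_iff] at h ⊢ <;> omega
  have hgood : ∀ i, condEnt p (W (f i)) T ≤ 0 := by
    rintro (i | i)
    · rw [← hdec d ⟨i, by omega⟩]
      refine condEnt_anti hp0 hp1 _ fun ω ω' e => ?_
      obtain ⟨h1, h2, h3, h4⟩ := hTdet ⟨i, by omega⟩ i.2 ω ω' e
      rw [h1, h3, h4]
    · rw [← hdec d' ⟨i, by omega⟩]
      refine condEnt_anti hp0 hp1 _ fun ω ω' e => ?_
      obtain ⟨h1, h2, h3, h4⟩ := hTdet ⟨i, by omega⟩ i.2 ω ω' e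
      rw [h2, h3, h4]
  let G : Finset (Fin N) := Finset.univ.image f
  have hG : G.card = 2 * l := by
    rw [Finset.card_image_of_injective _ hf]
    simp [two_mul]
  have hGc : ((Gᶜ).card : ℝ) = N - 2 * l := by
    rw [Finset.card_compl, hG, Fintype.card_fin, Nat.cast_sub (by omega)]
    push_cast
    rfl
  have hsum : ∑ n, condEnt p (W n) T ≤ (N - 2 * l) * B := by
    rw [← Finset.sum_add_sum_compl G]
    have h1 : ∑ n ∈ G, condEnt p (W n) T ≤ 0 := Finset.sum_nonpos fun n hn => by
      obtain ⟨i, -, rfl⟩ := Finset.mem_image.1 hn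
      exact hgood i
    have h2 : ∑ n ∈ Gᶜ, condEnt p (W n) T ≤ ∑ n ∈ Gᶜ, (B : ℝ) :=
      Finset.sum_le_sum fun n _ => (condEnt_le_ent hp0 hp1 _ _).trans_eq (hWent n)
    rw [Finset.sum_const, nsmul_eq_mul, hGc] at h2
    linarith
  have hjoint : ent p (fun ω => ((fun (n : {n : Fin N // n ≠ d k₀}) => W n.val ω), Y ω)) ≤
      ent p T + ∑ n, condEnt p (W n) T := by
    refine le_trans (ent_le_of_determines hp0 fun ω ω' e => ?_)
      (ent_family_le hp0 hp1 W T Finset.univ)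
    obtain ⟨e1, e2⟩ := Prod.ext_iff.1 e
    refine Prod.ext ?_ (congrArg (fun t => t.1.2) e1)
    funext n
    exact congrFun e2 ⟨n.val, Finset.mem_univ _⟩
  have hs0 := hsec d k₀
  unfold mutInf at hs0
  refine le_of_mul_le_mul_right ?_ hB'
  linarith
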